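/- There is no finite nonabelian simple group G with π(G) ⊆ {2,3}, i.e., no finite nonabelian simple group has order of the form 2^a·3^b. -/

import Mathlib

universe u

/-- If complex numbers of norm one have a sum of the largest possible norm, they are all equal. -/
lemma Multiset.card_mul_eq_sum_of_norm_sum_eq_card (M : Multiset ℂ) (hM : ∀ z ∈ M, ‖z‖ = 1)
    (hsum : ‖M.sum‖ = M.card) (z : ℂ) (hz : z ∈ M) : (M.card : ℂ) * z = M.sum := by
  obtain ⟨N, rfl⟩ := Multiset.exists_cons_of_mem hz
  have hN : ‖N.sum‖ ≤ N.card := by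
    refine (norm_multiset_sum_le N).trans ?_
    rw [Multiset.map_congr rfl fun x hx ↦ hM x (Multiset.mem_cons_of_mem hx)]
    simp
  have hz1 : ‖z‖ = 1 := hM z hz
  simp only [Multiset.sum_cons, Multiset.card_cons, Nat.cast_add, Nat.cast_one] at hsum ⊢
  have htri := norm_add_le z N.sum
  have hN' : ‖N.sum‖ = N.card := by linarith
  have hray : SameRay ℝ z N.sum := sameRay_iff_norm_add.2 (by linarith)
  have := hray.norm_smul_eq
  rw [hz1, hN', one_smul] at this
  rw [this, Complex.real_smul]
  push_cast
  ring

/-- In a number field, if an average of roots of unity is a nonzero algebraic integer, then it has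
norm at least one under every complex embedding. -/
lemma NumberField.one_le_norm_embedding_of_average_rootsOfUnity {K : Type*} [Field K]
    [NumberField K] {n : ℕ} (hn : n ≠ 0) (M : Multiset K) (hM : ∀ z ∈ M, z ^ n = 1) {a : K}
    (hcard : M.card ≠ 0) (ha : M.card * a = M.sum) (hint : IsIntegral ℤ a) (ha0 : a ≠ 0)
    (σ : K →ₐ[ℚ] ℂ) :
    1 ≤ ‖σ a‖ := by
  classical
  have hle (τ : K →ₐ[ℚ] ℂ) : ‖τ a‖ ≤ 1 := by
    have h := congrArg (fun x ↦ ‖τ x‖) ha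
    simp only [map_mul, map_natCast, norm_mul, map_multiset_sum] at h
    have h2 := norm_multiset_sum_le (M.map τ)
    rw [Multiset.map_map, Multiset.map_congr rfl (g := fun _ ↦ (1 : ℝ))] at h2
    · simp only [Complex.norm_natCast] at h
      rw [← h] at h2
      have : (0 : ℝ) < M.card := by positivity
      simp only [Multiset.map_const', Multiset.sum_replicate, nsmul_eq_mul, mul_one] at h2
      nlinarith
    · intro x hx
      refine Complex.norm_eq_one_of_pow_eq_one (n := n) ?_ hn
      rw [← map_pow, hM x hx, map_one]
  have hnorm := Algebra.norm_eq_prod_embeddings ℚ ℂ a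
  obtain ⟨m, hm⟩ := IsIntegrallyClosed.isIntegral_iff.1 (Algebra.isIntegral_norm ℚ hint)
  have hm0 : m ≠ 0 := by
    rintro rfl
    rw [map_zero, eq_comm, Algebra.norm_eq_zero_iff] at hm
    exact ha0 hm
  rw [← hm] at hnorm
  have h1 : (1 : ℝ) ≤ ‖∏ τ : K →ₐ[ℚ] ℂ, τ a‖ := by
    rw [← hnorm]
    simp only [eq_intCast, map_intCast, Complex.norm_intCast]
    exact_mod_cast Int.one_le_abs hm0
  rw [norm_prod, ← Finset.mul_prod_erase _ _ (Finset.mem_univ σ)] at h1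
  refine h1.trans (mul_le_of_le_one_right (norm_nonneg _) ?_)
  exact Finset.prod_le_one (fun _ _ ↦ norm_nonneg _) fun τ _ ↦ hle τ

/-- If an average of complex roots of unity is an algebraic integer, it is zero or all the roots
of unity are equal to it. -/
lemma eq_zero_or_forall_eq_of_average_rootsOfUnity {n : ℕ} (hn : n ≠ 0) (M : Multiset ℂ)
    (hM : ∀ z ∈ M, z ^ n = 1) (hM0 : M ≠ 0) {a : ℂ} (ha : M.card * a = M.sum)
    (hint : IsIntegral ℤ a) : a = 0 ∨ ∀ z ∈ M, z = a := by
  refine or_iff_not_imp_left.2 fun ha0 ↦ ?_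
  have hcard : (M.card : ℂ) ≠ 0 := by simpa using hM0
  have hnorm (z) (hz : z ∈ M) : ‖z‖ = 1 := Complex.norm_eq_one_of_pow_eq_one (hM z hz) hn
  let K := IntermediateField.adjoin ℚ {z : ℂ | z ^ n = 1}
  have hfin : Finite {z : ℂ | z ^ n = 1} := by
    have := (Polynomial.nthRootsFinset n (1 : ℂ)).finite_toSet
    refine this.subset fun z hz ↦ ?_
    simpa [Polynomial.mem_nthRootsFinset (Nat.pos_of_ne_zero hn)] using hz
  have hK : FiniteDimensional ℚ K := IntermediateField.finiteDimensional_adjoin fun x hx ↦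
    IsIntegral.of_pow (Nat.pos_of_ne_zero hn) (by rw [show x ^ n = 1 from hx]; exact isIntegral_one)
  have : NumberField K := { to_charZero := inferInstance, to_finiteDimensional := hK }
  have hMK (z) (hz : z ∈ M) : z ∈ K := IntermediateField.subset_adjoin _ _ (hM z hz)
  obtain ⟨M', rfl⟩ : ∃ M' : Multiset K, M'.map K.val = M := by
    lift M to Multiset K using hMK
    exact ⟨M, rfl⟩
  have hsum : ((M'.card * a : ℂ)) = K.val M'.sum := by
    rw [map_multiset_sum, ← ha, Multiset.card_map]
  rw [Multiset.card_map] at hcard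
  have ha' : K.val (M'.sum / M'.card) = a := by
    rw [map_div₀, ← hsum, map_natCast]
    field_simp
  have h1 : 1 ≤ ‖a‖ := by
    rw [← ha'] at hint ha0 ⊢
    refine NumberField.one_le_norm_embedding_of_average_rootsOfUnity hn M' ?_
      (by exact_mod_cast hcard) ?_ ?_ ?_ K.val
    · intro z hz
      apply K.val.injective
      rw [map_pow, map_one]
      exact hM _ (Multiset.mem_map_of_mem _ hz)
    · have : (M'.card : K) ≠ 0 := by exact_mod_cast hcard
      field_simp
    · exact (isIntegral_algHom_iff (K.val.restrictScalars ℤ) K.val.injective).1 hint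
    · rintro h
      rw [h, map_zero] at ha0
      exact ha0 rfl
  set M := M'.map K.val
  have hle : ‖M.sum‖ ≤ M.card := by
    refine (norm_multiset_sum_le M).trans ?_
    rw [Multiset.map_congr rfl hnorm]
    simp
  have hge : (M.card : ℝ) ≤ ‖M.sum‖ := by
    rw [← ha, norm_mul, Complex.norm_natCast]
    exact le_mul_of_one_le_right (Nat.cast_nonneg _) h1
  intro z hz
  have := M.card_mul_eq_sum_of_norm_sum_eq_card hnorm (le_antisymm hle hge) z hz
  rw [← ha] at this
  exact mul_left_cancel₀ (by simpa [M] using hcard) this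

/-- A complex matrix of finite order with only one eigenvalue is scalar. -/
lemma Matrix.eq_scalar_of_pow_eq_one_of_charpoly_roots {d n : ℕ} (hn : n ≠ 0)
    {A : Matrix (Fin d) (Fin d) ℂ} (hA : A ^ n = 1) {a : ℂ} (ha : ∀ z ∈ A.charpoly.roots, z = a) :
    A = Matrix.scalar (Fin d) a := by
  have hcp : A.charpoly = (Polynomial.X - Polynomial.C a) ^ d := by
    have h := (IsAlgClosed.splits A.charpoly).eq_prod_roots_of_monic A.charpoly_monic
    have hcard : A.charpoly.roots.card = d := by
      rw [← (IsAlgClosed.splits A.charpoly).natDegree_eq_card_roots, Matrix.charpoly_natDegree_eq_dim,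
        Fintype.card_fin]
    rw [Multiset.eq_replicate.2 ⟨hcard, ha⟩] at h
    simpa using h
  have h1 : minpoly ℂ A ∣ (Polynomial.X - Polynomial.C a) ^ d :=
    hcp ▸ minpoly.dvd ℂ A (Matrix.aeval_self_charpoly A)
  have h2 : minpoly ℂ A ∣ Polynomial.X ^ n - 1 := minpoly.dvd ℂ A (by simp [hA])
  have hsq : Squarefree (minpoly ℂ A) :=
    ((Polynomial.X_pow_sub_one_separable_iff.2 (by exact_mod_cast hn)).squarefree).squarefree_of_dvd
      h2
  rcases eq_or_ne d 0 with rfl | hd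
  · exact Subsingleton.elim _ _
  obtain ⟨q, hq⟩ := (hsq.dvd_pow_iff_dvd hd).1 h1
  have := congrArg (Polynomial.aeval A) hq
  rw [map_mul, minpoly.aeval, zero_mul, map_sub, Polynomial.aeval_X, Polynomial.aeval_C,
    sub_eq_zero] at this
  exact this

lemma Matrix.pow_eq_one_of_mem_charpoly_roots {d n : ℕ} {A : Matrix (Fin d) (Fin d) ℂ}
    (hA : A ^ n = 1) {z : ℂ} (hz : z ∈ A.charpoly.roots) : z ^ n = 1 := by
  have h := spectrum.pow_mem_pow A n
    (Matrix.mem_spectrum_iff_isRoot_charpoly.2 (Polynomial.isRoot_of_mem_roots hz))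
  have : Nontrivial (Matrix (Fin d) (Fin d) ℂ) := by
    rcases d with - | d
    · simp [Matrix.charpoly] at hz
    · infer_instance
  rw [hA, spectrum.one_eq] at h
  exact h

lemma Matrix.isIntegral_trace_of_pow_eq_one {d n : ℕ} (hn : n ≠ 0)
    {A : Matrix (Fin d) (Fin d) ℂ} (hA : A ^ n = 1) : IsIntegral ℤ A.trace := by
  rw [Matrix.trace_eq_sum_roots_charpoly]
  refine IsIntegral.multiset_sum fun z hz ↦ IsIntegral.of_pow (Nat.pos_of_ne_zero hn) ?_
  rw [Matrix.pow_eq_one_of_mem_charpoly_roots hA hz]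
  exact isIntegral_one

/-- If `A` is a complex matrix of finite order and its trace divided by its size is an algebraic
integer, then `A` has trace zero or is scalar. -/
lemma Matrix.trace_eq_zero_or_eq_scalar {d n : ℕ} (hd : d ≠ 0) (hn : n ≠ 0)
    {A : Matrix (Fin d) (Fin d) ℂ} (hA : A ^ n = 1) {a : ℂ} (ha : d * a = A.trace)
    (hint : IsIntegral ℤ a) : A.trace = 0 ∨ A = Matrix.scalar (Fin d) a := by
  have hcard : A.charpoly.roots.card = d := by
    rw [← (IsAlgClosed.splits A.charpoly).natDegree_eq_card_roots, Matrix.charpoly_natDegree_eq_dim,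
      Fintype.card_fin]
  rcases eq_zero_or_forall_eq_of_average_rootsOfUnity hn A.charpoly.roots
    (fun z hz ↦ Matrix.pow_eq_one_of_mem_charpoly_roots hA hz)
    (by rw [← Multiset.card_pos, hcard]; omega)
    (by rw [hcard, ha, Matrix.trace_eq_sum_roots_charpoly]) hint with h | h
  · left
    rw [← ha, h, mul_zero]
  · exact .inr (Matrix.eq_scalar_of_pow_eq_one_of_charpoly_roots hn hA h)

section Representation

variable {G : Type*} [Group G]

open MonoidAlgebra

lemma MonoidAlgebra.single_commute_sum_of_conj_mem {R : Type*} [Semiring R] {s : Finset G}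
    (hs : ∀ g, ∀ y ∈ s, g * y * g⁻¹ ∈ s) (g : G) :
    Commute (single g (1 : R)) (∑ y ∈ s, single y 1) := by
  simp only [Commute, SemiconjBy, Finset.mul_sum, Finset.sum_mul, single_mul_single, mul_one]
  refine Finset.sum_nbij' (fun y ↦ g * y * g⁻¹) (fun y ↦ g⁻¹ * y * g) (hs g) ?_ ?_ ?_ ?_
  · intro y hy
    simpa using hs g⁻¹ y hy
  · intro y _
    simp [mul_assoc]
  · intro y _
    simp [mul_assoc]
  · intro y _
    simp [mul_assoc]

/-- The trace of left multiplication by `a` on a product of matrix algebras. -/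
lemma LinearMap.trace_mulLeft_pi_matrix {R : Type*} [CommRing R] {m : ℕ} (d : Fin m → ℕ)
    (a : ∀ i, Matrix (Fin (d i)) (Fin (d i)) R) :
    LinearMap.trace R _ (LinearMap.mulLeft R a) = ∑ i, (d i : R) * (a i).trace := by
  rw [LinearMap.trace_eq_matrix_trace R (Pi.basis fun i ↦ Matrix.stdBasis R (Fin (d i)) (Fin (d i)))]
  simp only [Matrix.trace, Matrix.diag, Fintype.sum_sigma, Fintype.sum_prod_type,
    LinearMap.toMatrix_apply, Pi.basis_apply, Pi.basis_repr, LinearMap.mulLeft_apply, Pi.mul_apply,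
    Pi.single_eq_same, Matrix.stdBasis_eq_single, Finset.mul_sum]
  refine Finset.sum_congr rfl fun i _ ↦ Finset.sum_congr rfl fun j _ ↦ ?_
  have (k : Fin (d i)) : (((Matrix.stdBasis R (Fin (d i)) (Fin (d i))).repr
      (a i * Matrix.single j k 1)) (j, k)) = a i j j := by
    rw [show ∀ A : Matrix (Fin (d i)) (Fin (d i)) R,
      (Matrix.stdBasis R (Fin (d i)) (Fin (d i))).repr A (j, k) = A j k from fun A ↦ rfl]
    simp
  simp [this]

lemma LinearMap.trace_mulLeft_monoidAlgebra_single {R : Type*} [CommRing R] [Finite G] {g : G}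
    (hg : g ≠ 1) :
    LinearMap.trace R _ (LinearMap.mulLeft R (MonoidAlgebra.single g (1 : R))) = 0 := by
  classical
  have := Fintype.ofFinite G
  rw [LinearMap.trace_eq_matrix_trace R (MonoidAlgebra.basis G R)]
  refine Finset.sum_eq_zero fun y _ ↦ ?_
  rw [Matrix.diag_apply, LinearMap.toMatrix_apply, MonoidAlgebra.basis_apply,
    LinearMap.mulLeft_apply, MonoidAlgebra.single_mul_single]
  change (MonoidAlgebra.single (g * y) (1 * 1) : MonoidAlgebra R G).coeff y = 0
  simp [hg]

section AlgHom

variable {d : ℕ} {ψ : MonoidAlgebra ℂ G →ₐ[ℂ] Matrix (Fin d) (Fin d) ℂ}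

lemma map_sum_eq_scalar_of_conj_mem (hψ : Function.Surjective ψ) {s : Finset G}
    (hs : ∀ g, ∀ y ∈ s, g * y * g⁻¹ ∈ s) :
    ∃ c : ℂ, ψ (∑ y ∈ s, single y 1) = Matrix.scalar (Fin d) c := by
  have : ψ (∑ y ∈ s, single y 1) ∈ Set.center (Matrix (Fin d) (Fin d) ℂ) := by
    rw [Semigroup.mem_center_iff]
    intro B
    obtain ⟨b, rfl⟩ := hψ B
    rw [← map_mul, ← map_mul]
    congr 1
    induction b using MonoidAlgebra.induction_on with
    | of g => exact single_commute_sum_of_conj_mem hs g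
    | add x y hx hy => rw [add_mul, mul_add, hx, hy]
    | smul r x hx => rw [smul_mul_assoc, hx, mul_smul_comm]
  rw [Matrix.center_eq_range] at this
  exact this.imp fun _ h ↦ h.symm

lemma map_sum_univ_eq_zero [Fintype G] (hψ : Function.Surjective ψ) {g : G} (hg : ψ (single g 1) ≠ 1) :
    ψ (∑ y, single y 1) = 0 := by
  obtain ⟨c, hc⟩ := map_sum_eq_scalar_of_conj_mem hψ (s := Finset.univ) (by simp)
  have h : ψ (single g 1) * ψ (∑ y, single y 1) = ψ (∑ y, single y 1) := by
    rw [← map_mul, Finset.mul_sum]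
    simp only [single_mul_single, mul_one]
    congr 1
    exact Fintype.sum_equiv (Equiv.mulLeft g) _ _ fun y ↦ rfl
  have h0 : c • (ψ (single g 1) - 1) = 0 := by
    rw [hc, ← sub_eq_zero] at h
    rw [← h, smul_sub, Matrix.scalar_apply, ← Matrix.smul_one_eq_diagonal]
    simp
  rcases smul_eq_zero.1 h0 with h0 | h0
  · rw [hc, h0, map_zero]
  · exact absurd (sub_eq_zero.1 h0) hg

lemma isIntegral_of_map_sum_eq_scalar [Finite G] (hd : d ≠ 0) {s : Finset G} {c : ℂ}
    (hc : ψ (∑ y ∈ s, single y 1) = Matrix.scalar (Fin d) c) : IsIntegral ℤ c := by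
  let F : MonoidAlgebra ℤ G →+* Matrix (Fin d) (Fin d) ℂ :=
    (ψ : MonoidAlgebra ℂ G →+* Matrix (Fin d) (Fin d) ℂ).comp
      (MonoidAlgebra.mapRingHom G (Int.castRingHom ℂ))
  have hF : F.toIntAlgHom (∑ y ∈ s, single y 1) = Matrix.scalar (Fin d) c := by
    rw [← hc]
    simp [F, map_sum]
  have : NeZero d := ⟨hd⟩
  have hinj : Function.Injective (Matrix.scalar (α := ℂ) (Fin d)).toIntAlgHom :=
    fun _ _ h ↦ Matrix.scalar_inj.1 h
  rw [← isIntegral_algHom_iff _ hinj]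
  change IsIntegral ℤ (Matrix.scalar (Fin d) c)
  rw [← hF]
  exact (IsIntegral.of_finite ℤ _).map F.toIntAlgHom

lemma map_single_pow_card (g : G) : ψ (single g 1) ^ Nat.card G = 1 := by
  rw [← map_pow, single_pow, one_pow, pow_card_eq_one', ← one_def, map_one]

lemma trace_eq_zero_or_eq_scalar_of_coprime_card_conj [Fintype G]
    (hψ : Function.Surjective ψ) (hd : d ≠ 0) {s : Finset G} {x : G} (hs : ∀ y, y ∈ s ↔ IsConj x y) (hcop : s.card.Coprime d) :
    (ψ (single x 1)).trace = 0 ∨ ∃ c, ψ (single x 1) = Matrix.scalar (Fin d) c := by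
  obtain ⟨c, hc⟩ := map_sum_eq_scalar_of_conj_mem hψ (s := s) fun g y hy ↦ by
    rw [hs] at hy ⊢
    exact hy.trans (isConj_iff.2 ⟨g, rfl⟩)
  have hcint := isIntegral_of_map_sum_eq_scalar hd hc
  have htr : (s.card : ℂ) * (ψ (single x 1)).trace = d * c := by
    have h := congrArg Matrix.trace hc
    rw [map_sum, Matrix.trace_sum, Finset.sum_congr rfl (g := fun _ ↦ (ψ (single x 1)).trace)] at h
    · simpa [Matrix.trace] using h
    · intro y hy
      obtain ⟨g, rfl⟩ := isConj_iff.1 ((hs y).1 hy)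
      have : (single (g * x * g⁻¹) (1 : ℂ)) = single g 1 * single x 1 * single g⁻¹ 1 := by
        simp [single_mul_single]
      rw [this, map_mul, Matrix.trace_mul_comm, ← map_mul, ← mul_assoc, single_mul_single]
      simp [← one_def]
  have hint := Matrix.isIntegral_trace_of_pow_eq_one Nat.card_pos.ne'
    (map_single_pow_card (ψ := ψ) x)
  obtain ⟨u, v, huv⟩ := Nat.isCoprime_iff_coprime.2 hcop
  have huv' : (u : ℂ) * s.card + v * d = 1 := by exact_mod_cast huv
  refine (Matrix.trace_eq_zero_or_eq_scalar hd Nat.card_pos.ne'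
    (map_single_pow_card (ψ := ψ) x) (a := u * c + v * (ψ (single x 1)).trace) ?_ ?_).imp_right
      fun h ↦ ⟨_, h⟩
  · linear_combination (ψ (single x 1)).trace * huv' - u * htr
  · exact (((isIntegral_algebraMap (R := ℤ) (x := u)).mul hcint).add
      ((isIntegral_algebraMap (R := ℤ) (x := v)).mul hint))

/-- A nontrivial representation of a nonabelian simple group maps no nontrivial element to a
scalar. -/
lemma map_single_ne_scalar [IsSimpleGroup G] (hG : ¬ ∀ a b : G, a * b = b * a) {g x : G}
    (hg : ψ (single g 1) ≠ 1) (hx : x ≠ 1) (c : ℂ) :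
    ψ (single x 1) ≠ Matrix.scalar (Fin d) c := by
  intro hc
  let ρ : G →* Matrix (Fin d) (Fin d) ℂ := (ψ : _ →* _).comp (MonoidAlgebra.of ℂ G)
  have hker : ρ.ker = ⊥ := by
    refine (ρ.normal_ker.eq_bot_or_eq_top).resolve_right fun h ↦ hg ?_
    have : g ∈ ρ.ker := h ▸ Subgroup.mem_top g
    exact this
  have hinj : Function.Injective ρ := (MonoidHom.ker_eq_bot_iff ρ).1 hker
  have hcen : x ∈ Subgroup.center G := by
    rw [Subgroup.mem_center_iff]
    intro y
    apply hinj
    rw [map_mul, map_mul, show ρ x = Matrix.scalar (Fin d) c from hc]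
    exact ((Matrix.scalar_commute c (fun _ ↦ Commute.all _ _) (ρ y)).eq).symm
  rcases (inferInstance : (Subgroup.center G).Normal).eq_bot_or_eq_top with h | h
  · rw [h, Subgroup.mem_bot] at hcen
    exact hx hcen
  · refine hG fun a b ↦ ?_
    have : b ∈ Subgroup.center G := h ▸ Subgroup.mem_top b
    exact Subgroup.mem_center_iff.1 this a

/-- In a nonabelian simple group, the size of the conjugacy class of a nontrivial element is not a
power of a prime. -/
theorem exists_prime_dvd_card_conj_ne [Fintype G] [IsSimpleGroup G]
    (hG : ¬ ∀ a b : G, a * b = b * a) {p : ℕ} (hp : p.Prime) {x : G} (hx : x ≠ 1) {s : Finset G} (hs : ∀ y, y ∈ s ↔ IsConj x y) :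
    ∃ q : ℕ, q.Prime ∧ q ∣ s.card ∧ q ≠ p := by
  classical
  by_contra! hcard
  obtain ⟨m, d, hd, ⟨φ⟩⟩ :=
    IsSemisimpleRing.exists_algEquiv_pi_matrix_of_isAlgClosed ℂ (MonoidAlgebra ℂ G)
  let ψ (i : Fin m) : MonoidAlgebra ℂ G →ₐ[ℂ] Matrix (Fin (d i)) (Fin (d i)) ℂ :=
    (Pi.evalAlgHom ℂ _ i).comp φ.toAlgHom
  have hψ (i) : Function.Surjective (ψ i) := (Function.surjective_eval i).comp φ.surjective
  have hreg (a : MonoidAlgebra ℂ G) : LinearMap.trace ℂ _ (LinearMap.mulLeft ℂ a) =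
      ∑ i, (d i : ℂ) * (ψ i a).trace := by
    rw [← LinearMap.trace_conj' _ φ.toLinearEquiv]
    refine Eq.trans ?_ (LinearMap.trace_mulLeft_pi_matrix d (φ a))
    congr 1
    refine LinearMap.ext fun b ↦ ?_
    simp [LinearEquiv.conj_apply]
  let T : Finset (Fin m) := {i | ∀ g, ψ i (single g 1) = 1}
  have hT : ∑ i ∈ T, (d i : ℂ) * d i = 1 := by
    have h1 : LinearMap.trace ℂ _ (LinearMap.mulLeft ℂ (∑ y : G, single y (1 : ℂ))) =
        Fintype.card G := by
      have : LinearMap.mulLeft ℂ (∑ y : G, single y (1 : ℂ)) =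
          ∑ y : G, LinearMap.mulLeft ℂ (single y (1 : ℂ)) := by
        refine LinearMap.ext fun b ↦ ?_
        simp [Finset.sum_mul]
      rw [this, map_sum, Finset.sum_eq_single 1
        (fun y _ hy ↦ LinearMap.trace_mulLeft_monoidAlgebra_single hy) (by simp), ← one_def,
        LinearMap.mulLeft_one, LinearMap.trace_id,
        Module.finrank_eq_card_basis (MonoidAlgebra.basis G ℂ)]
    rw [hreg, ← Finset.sum_subset (Finset.subset_univ T)] at h1
    · have h2 : ∑ i ∈ T, (d i : ℂ) * (ψ i (∑ y : G, single y (1 : ℂ))).trace =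
          Fintype.card G * ∑ i ∈ T, (d i : ℂ) * d i := by
        rw [Finset.mul_sum]
        refine Finset.sum_congr rfl fun i hi ↦ ?_
        rw [map_sum, Finset.sum_congr rfl fun y _ ↦ (Finset.mem_filter.1 hi).2 y]
        rw [Matrix.trace_sum, Matrix.trace_one, Fintype.card_fin, Finset.sum_const, nsmul_eq_mul,
          Finset.card_univ]
        ring
      rw [h1] at h2
      have : (Fintype.card G : ℂ) ≠ 0 := by exact_mod_cast Fintype.card_ne_zero
      exact (mul_left_cancel₀ this (by rw [mul_one]; exact h2)).symm
    · intro i _ hi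
      obtain ⟨g, hg⟩ : ∃ g, ψ i (single g 1) ≠ 1 := by simpa [T] using hi
      rw [map_sum_univ_eq_zero (hψ i) hg, Matrix.trace_zero, mul_zero]
  have hzero : ∑ i, (d i : ℂ) * (ψ i (single x 1)).trace = 0 := by
    rw [← hreg, LinearMap.trace_mulLeft_monoidAlgebra_single hx]
  have hdiv (i) (hi : i ∉ T) :
      ∃ b : ℂ, IsIntegral ℤ b ∧ (d i : ℂ) * (ψ i (single x 1)).trace = p * b := by
    obtain ⟨g, hg⟩ : ∃ g, ψ i (single g 1) ≠ 1 := by simpa [T] using hi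
    by_cases hpd : p ∣ d i
    · obtain ⟨k, hk⟩ := hpd
      refine ⟨k * (ψ i (single x 1)).trace, ?_, by rw [← mul_assoc, ← Nat.cast_mul, ← hk]⟩
      exact (isIntegral_algebraMap (R := ℤ) (x := k)).mul
        (Matrix.isIntegral_trace_of_pow_eq_one Nat.card_pos.ne' (map_single_pow_card x))
    · refine ⟨0, isIntegral_zero, ?_⟩
      have hcop : s.card.Coprime (d i) := by
        refine Nat.coprime_of_dvd fun q hq hqs hqd ↦ hpd ?_
        rwa [← hcard q hq hqs]
      rcases trace_eq_zero_or_eq_scalar_of_coprime_card_conj (hψ i) (hd i).out hs hcop with h | ⟨c, h⟩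
      · rw [h, mul_zero, mul_zero]
      · exact absurd h (map_single_ne_scalar hG hg hx c)
  choose! b hbint hb using hdiv
  rw [← Finset.sum_add_sum_compl T, Finset.sum_congr rfl (g := fun i ↦ (d i : ℂ) * d i), hT,
    Finset.sum_congr rfl (fun i hi ↦ hb i (Finset.mem_compl.1 hi)), ← Finset.mul_sum] at hzero
  · have hint : IsIntegral ℤ (algebraMap ℚ ℂ (-(p : ℚ)⁻¹)) := by
      have hp0 : (p : ℂ) ≠ 0 := by exact_mod_cast hp.ne_zero
      rw [show algebraMap ℚ ℂ (-(p : ℚ)⁻¹) = ∑ i ∈ Tᶜ, b i by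
        simp only [map_neg, map_inv₀, map_natCast]
        field_simp
        linear_combination -hzero]
      exact IsIntegral.sum _ fun i hi ↦ hbint i (Finset.mem_compl.1 hi)
    obtain ⟨k, hk⟩ := IsIntegrallyClosed.isIntegral_iff.1
      ((isIntegral_algebraMap_iff (algebraMap ℚ ℂ).injective).1 hint)
    have hp0 : (p : ℚ) ≠ 0 := by exact_mod_cast hp.ne_zero
    have hk' : (k * p : ℚ) = -1 := by
      rw [show (k : ℚ) = -(p : ℚ)⁻¹ from hk]
      field_simp
    have hk2 : k * p = -1 := by exact_mod_cast hk'
    have : (p : ℤ) ∣ 1 := ⟨-k, by linarith⟩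
    exact hp.one_lt.ne' (by exact_mod_cast Int.eq_one_of_dvd_one (by positivity) this)
  · intro i hi
    rw [(Finset.mem_filter.1 hi).2 x, Matrix.trace_one, Fintype.card_fin]

end AlgHom

end Representation

/-- There is no finite nonabelian simple group `G` with `π(G) ⊆ {2, 3}`, i.e.,
no finite nonabelian simple group has order of the form `2^a * 3^b`. -/
theorem no_simple_group_of_two_three_order (G : Type u) [Group G] [Finite G] :
    ¬ (IsSimpleGroup G ∧ (¬ ∀ a b : G, a * b = b * a) ∧
        ∀ p : ℕ, p.Prime → p ∣ Nat.card G → p = 2 ∨ p = 3) := by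
  classical
  rintro ⟨hsimple, hG, hcard⟩
  have := Fintype.ofFinite G
  obtain ⟨p, hp, hpG⟩ := Nat.exists_prime_and_dvd (Finite.one_lt_card (α := G)).ne'
  have : Fact p.Prime := ⟨hp⟩
  obtain ⟨q, hq, hpq⟩ : ∃ q : ℕ, q.Prime ∧ ∀ r : ℕ, r.Prime → r ∣ Nat.card G → r ≠ p → r = q := by
    rcases hcard p hp hpG with rfl | rfl
    · exact ⟨3, Nat.prime_three, fun r hr hrG h ↦ (hcard r hr hrG).resolve_left h⟩
    · exact ⟨2, Nat.prime_two, fun r hr hrG h ↦ (hcard r hr hrG).resolve_right h⟩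
  obtain ⟨P⟩ : Nonempty (Sylow p G) := inferInstance
  have : Nontrivial P := by
    rw [← Finite.one_lt_card_iff_nontrivial]
    exact hp.one_lt.trans_le (Nat.le_of_dvd Nat.card_pos (P.dvd_card_of_dvd_card hpG))
  obtain ⟨⟨z, hz⟩, hz1⟩ := (nontrivial_iff_exists_ne 1).1 P.2.center_nontrivial
  have hx : (z : G) ≠ 1 := fun h ↦ hz1 (Subtype.ext (Subtype.ext h))
  have hP : (P : Subgroup G) ≤ Subgroup.centralizer {(z : G)} := by
    intro y hy
    rw [Subgroup.mem_centralizer_singleton_iff]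
    exact congrArg Subtype.val (Subgroup.mem_center_iff.1 hz ⟨y, hy⟩)
  let s : Finset G := {y | IsConj (z : G) y}
  have hs : s.card = (Subgroup.centralizer {(z : G)}).index := by
    have hstab : (Subgroup.centralizer {(z : G)}).index =
        (MulAction.stabilizer (ConjAct G) (z : G)).index := by
      have h1 := (Subgroup.centralizer {(z : G)}).card_mul_index
      rw [Subgroup.nat_card_centralizer_nat_card_stabilizer,
        Nat.card_congr (ConjAct.toConjAct (G := G)).toEquiv,
        ← (MulAction.stabilizer (ConjAct G) (z : G)).card_mul_index] at h1
      exact Nat.eq_of_mul_eq_mul_left Nat.card_pos h1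
    rw [hstab, MulAction.index_stabilizer, ← Set.ncard_coe_finset]
    congr 1
    ext y
    simp only [s, Finset.coe_filter, Finset.mem_univ, true_and, Set.mem_ofPred_eq,
      ConjAct.mem_orbit_conjAct]
    exact isConj_comm
  obtain ⟨r, hr, hrs, hrq⟩ := exists_prime_dvd_card_conj_ne hG hq hx (s := s) (by simp [s])
  rw [hs] at hrs
  refine hrq (hpq r hr (hrs.trans (Subgroup.index_dvd_card _)) ?_)
  rintro rfl
  exact P.not_dvd_index (hrs.trans (Subgroup.index_dvd_of_le hP))
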